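/- Let λ be a maximal line of a GC_n set X such that the GC_{n−1} set X \ λ has at least 3 maximal lines, i.e., μ(X\λ) ≥ 3. Then μ(X\λ) = μ(X) or μ(X\λ) = μ(X) − 1. -/

import Mathlib

open MvPolynomial

/-- Bivariate real polynomials. -/
abbrev Poly2 : Type := MvPolynomial (Fin 2) ℝ

/-- Evaluation of a bivariate polynomial at a point of `ℝ²`. -/
noncomputable def evalPt (p : Poly2) (A : ℝ × ℝ) : ℝ :=
  MvPolynomial.eval (fun i => if i = 0 then A.1 else A.2) p

/-- `X` is an `n`-poised set: it has `(n+2 choose 2)` nodes and the only polynomial of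
total degree at most `n` vanishing on all of `X` is the zero polynomial. -/
def IsPoised (n : ℕ) (X : Finset (ℝ × ℝ)) : Prop :=
  X.card = (n + 2).choose 2 ∧
    ∀ p : Poly2, p.totalDegree ≤ n → (∀ A ∈ X, evalPt p A = 0) → p = 0

/-- `p` is an `n`-fundamental polynomial of the node `A` with respect to `X`. -/
def IsFund (n : ℕ) (X : Finset (ℝ × ℝ)) (A : ℝ × ℝ) (p : Poly2) : Prop :=
  p.totalDegree ≤ n ∧ evalPt p A = 1 ∧ ∀ B ∈ X, B ≠ A → evalPt p B = 0

/-- `X` is a `GC_n` set: `n`-poised and each node has a fundamental polynomial which is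
a product of `n` polynomials of degree 1. -/
def IsGC (n : ℕ) (X : Finset (ℝ × ℝ)) : Prop :=
  IsPoised n X ∧
    ∀ A ∈ X, ∃ p : Poly2, IsFund n X A p ∧
      ∃ f : Fin n → Poly2, (∀ i, (f i).totalDegree = 1) ∧ p = ∏ i, f i

/-- The nodes of `X` lying on the zero set of `ℓ`. -/
noncomputable def nodesOn (X : Finset (ℝ × ℝ)) (ℓ : Poly2) : Finset (ℝ × ℝ) :=
  @Finset.filter _ (fun A => evalPt ℓ A = 0) (Classical.decPred _) X

/-- `ℓ` is a `k`-node line of `X`: it has degree exactly 1 and passes through exactly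
`k` nodes of `X`. -/
def IsKNodeLine (X : Finset (ℝ × ℝ)) (ℓ : Poly2) (k : ℕ) : Prop :=
  ℓ.totalDegree = 1 ∧ (nodesOn X ℓ).card = k

/-- A maximal line of an `n`-poised set: an `(n+1)`-node line. -/
def IsMaximalLine (n : ℕ) (X : Finset (ℝ × ℝ)) (ℓ : Poly2) : Prop :=
  IsKNodeLine X ℓ (n + 1)

/-- The zero set of a polynomial, i.e. the line it determines when it has degree 1. -/
def zeroSet (ℓ : Poly2) : Set (ℝ × ℝ) := {A | evalPt ℓ A = 0}

/-- `μ(X)`: the number of maximal lines (as subsets of the plane) of `X`. -/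
noncomputable def mu (n : ℕ) (X : Finset (ℝ × ℝ)) : ℕ :=
  {L : Set (ℝ × ℝ) | ∃ ℓ : Poly2, IsMaximalLine n X ℓ ∧ L = zeroSet ℓ}.ncard

/-- The node `A` of `X` uses the line `ℓ`: `ℓ` divides a fundamental polynomial of `A`. -/
def Uses (n : ℕ) (X : Finset (ℝ × ℝ)) (ℓ : Poly2) (A : ℝ × ℝ) : Prop :=
  ∃ p : Poly2, IsFund n X A p ∧ ℓ ∣ p

/-- `X_ℓ`: the set of nodes of `X` using the line `ℓ`. -/
noncomputable def usesSet (n : ℕ) (X : Finset (ℝ × ℝ)) (ℓ : Poly2) : Finset (ℝ × ℝ) :=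
  @Finset.filter _ (Uses n X ℓ) (Classical.decPred _) X

/-- The Gasca–Maeztu conjecture for degree `m`: every `GC_m` set has a maximal line. -/
def GM (m : ℕ) : Prop :=
  ∀ Y : Finset (ℝ × ℝ), IsGC m Y → ∃ lam : Poly2, IsMaximalLine m Y lam

lemma evalPt_mul (p q : Poly2) (A : ℝ × ℝ) : evalPt (p * q) A = evalPt p A * evalPt q A := by
  simp [evalPt]

lemma evalPt_sub (p q : Poly2) (A : ℝ × ℝ) : evalPt (p - q) A = evalPt p A - evalPt q A := by
  simp [evalPt]

lemma evalPt_C (c : ℝ) (A : ℝ × ℝ) : evalPt (C c) A = c := by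
  simp [evalPt]

lemma evalPt_zero (A : ℝ × ℝ) : evalPt 0 A = 0 := by
  simp [evalPt]

lemma mem_nodesOn {X : Finset (ℝ × ℝ)} {l : Poly2} {A : ℝ × ℝ} :
    A ∈ nodesOn X l ↔ A ∈ X ∧ evalPt l A = 0 := by
  unfold nodesOn
  exact @Finset.mem_filter _ _ (Classical.decPred _) _ _

lemma lin_form (l : Poly2) (h : l.totalDegree = 1) :
    ∃ a b c : ℝ, l = C a * X 0 + C b * X 1 + C c ∧ a ^ 2 + b ^ 2 ≠ 0 := by
  have key : l = C (coeff (Finsupp.single 0 1) l) * X 0 +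
      C (coeff (Finsupp.single 1 1) l) * X 1 + C (coeff 0 l) := by
    ext m
    by_cases hm : 1 < m 0 + m 1
    · have h1 : coeff m l = 0 := by
        apply coeff_eq_zero_of_totalDegree_lt
        rw [h]
        have : m.degree = m 0 + m 1 := by
          rw [Finsupp.degree_eq_sum]; simp
        calc 1 < m.degree := by omega
          _ = _ := rfl
      have e0 : Finsupp.single (0 : Fin 2) 1 ≠ m := by
        rintro rfl; simp at hm
      have e1 : Finsupp.single (1 : Fin 2) 1 ≠ m := by
        rintro rfl; simp at hm
      have e2 : (0 : Fin 2 →₀ ℕ) ≠ m := by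
        rintro rfl; simp at hm
      simp [h1, coeff_C_mul, coeff_X, coeff_C, e0, e1, e2]
    · have hc : m = 0 ∨ m = Finsupp.single 0 1 ∨ m = Finsupp.single 1 1 := by
        rcases Nat.eq_zero_or_pos (m 0) with h0 | h0
        · rcases Nat.eq_zero_or_pos (m 1) with h1 | h1
          · left; ext i; fin_cases i <;> simp [h0, h1]
          · right; right
            have : m 1 = 1 := by omega
            ext i; fin_cases i <;> simp [h0, this]
        · right; left
          have : m 0 = 1 := by omega
          have : m 1 = 0 := by omega
          ext i; fin_cases i <;> simp [*]
      rcases hc with rfl | rfl | rfl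
      · simp [coeff_C_mul, coeff_X, coeff_C]
      · simp [coeff_C_mul, coeff_X, coeff_C, Finsupp.single_left_inj]
        intro h'
        simpa using DFunLike.congr_fun h' 0
      · simp [coeff_C_mul, coeff_X, coeff_C, Finsupp.single_left_inj]
        intro h'
        simpa using DFunLike.congr_fun h' 1
  refine ⟨_, _, _, key, ?_⟩
  intro h0
  have ha : coeff (Finsupp.single 0 1) l = 0 := by nlinarith [sq_nonneg (coeff (Finsupp.single 0 1) l), sq_nonneg (coeff (Finsupp.single 1 1) l)]
  have hb : coeff (Finsupp.single 1 1) l = 0 := by nlinarith [sq_nonneg (coeff (Finsupp.single 0 1) l), sq_nonneg (coeff (Finsupp.single 1 1) l)]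
  rw [ha, hb] at key
  simp at key
  rw [key] at h
  simp at h

lemma line_dvd (l p : Poly2) (d : ℕ) (S : Finset (ℝ × ℝ)) (hl : l.totalDegree = 1)
    (hp : p.totalDegree ≤ d) (hSl : ∀ A ∈ S, evalPt l A = 0) (hSp : ∀ A ∈ S, evalPt p A = 0)
    (hS : d < S.card) : ∃ r, p = l * r ∧ (r = 0 ∨ r.totalDegree + 1 ≤ d) := by
  obtain ⟨a, b, c, rfl, hs⟩ := lin_form l hl
  set s := a ^ 2 + b ^ 2 with hsdef
  set l : Poly2 := C a * X 0 + C b * X 1 + C c with hldef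
  let g : Fin 2 → Polynomial ℝ := fun i => if i = 0 then
    Polynomial.C (-a * c / s) + Polynomial.C (-b) * Polynomial.X else
    Polynomial.C (-b * c / s) + Polynomial.C a * Polynomial.X
  let T : Poly2 := C (-b / s) * X 0 + C (a / s) * X 1
  have hφ : aeval g p = 0 := by
    have hdeg : (aeval g p).natDegree ≤ d := by
      have := MvPolynomial.aeval_natDegree_le p hp g (by
        intro i
        by_cases hi : i = 0
        · simp only [g, hi, if_true]; compute_degree
        · simp only [g, hi, if_false]; compute_degree; simp)
      simpa using this
    let t : ℝ × ℝ → ℝ := fun A => (-b * A.1 + a * A.2) / s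
    have hpt : ∀ A ∈ S, -a * c / s - b * t A = A.1 ∧ -b * c / s + a * t A = A.2 := by
      intro A hA
      have := hSl A hA
      simp [l, evalPt] at this
      have hc : c = - a * A.1 - b * A.2 := by linarith
      constructor
      · simp only [t]; field_simp; rw [hc, hsdef]; ring
      · simp only [t]; field_simp; rw [hc, hsdef]; ring
    have hroot : ∀ A ∈ S, (aeval g p).eval (t A) = 0 := by
      intro A hA
      rw [← hSp A hA]
      have : ∀ p : Poly2, (aeval g p).eval (t A) = eval (fun i => (g i).eval (t A)) p := by
        intro p
        induction p using MvPolynomial.induction_on with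
        | C x => simp
        | add p q hp hq => simp_all
        | mul_X p i hp => simp_all
      rw [this, evalPt]
      congr 2
      funext i
      obtain ⟨h1, h2⟩ := hpt A hA
      by_cases hi : i = 0
      · simp only [g, hi, if_true]; simp; rw [← h1]; ring
      · simp only [g, hi, if_false]; simp; rw [← h2]; ring
    apply Polynomial.eq_zero_of_natDegree_lt_card_of_eval_eq_zero' _ (S.image t)
    · intro x hx
      obtain ⟨A, hA, rfl⟩ := Finset.mem_image.1 hx
      exact hroot A hA
    · rw [Finset.card_image_of_injOn]
      · omega
      · intro A hA B hB hAB
        have h1 := hpt A hA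
        have h2 := hpt B hB
        rw [hAB] at h1
        exact Prod.ext (h1.1.symm.trans h2.1) (h1.2.symm.trans h2.2)
  have hdvd : l ∣ p := by
    rw [← Ideal.mem_span_singleton, ← Ideal.Quotient.eq_zero_iff_mem]
    have : (Ideal.Quotient.mkₐ ℝ (Ideal.span {l})) p =
        Polynomial.aeval (Ideal.Quotient.mkₐ ℝ (Ideal.span {l}) T) (aeval g p) := by
      have : (Ideal.Quotient.mkₐ ℝ (Ideal.span {l})) =
          (Polynomial.aeval (Ideal.Quotient.mkₐ ℝ (Ideal.span {l}) T)).comp (aeval g) := by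
        apply MvPolynomial.algHom_ext
        intro i
        have hgi : ∀ q : Polynomial ℝ, Polynomial.aeval (Ideal.Quotient.mkₐ ℝ (Ideal.span {l}) T) q
            = Ideal.Quotient.mkₐ ℝ (Ideal.span {l}) (Polynomial.aeval T q) := by
          intro q; rw [Polynomial.aeval_algHom_apply]
        rw [AlgHom.comp_apply, aeval_X, hgi]
        simp only [Ideal.Quotient.mkₐ_eq_mk]
        rw [Ideal.Quotient.eq, Ideal.mem_span_singleton]
        by_cases hi : i = 0
        · refine ⟨C (a / s), ?_⟩
          simp only [g, hi, if_true, T, l]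
          simp only [map_add, map_mul, Polynomial.aeval_C, Polynomial.aeval_X, algebraMap_eq]
          have e1 : (C (-a * c / s) : Poly2) = - C c * C (a / s) := by
            rw [← C_neg, ← C_mul]; congr 1; ring
          have e2 : (1 : Poly2) = C a * C (a / s) + C b * C (b / s) := by
            rw [← C_mul, ← C_mul, ← C_add, ← C_1]; congr 1; field_simp; rw [hsdef]
          have e3 : (C (-b / s) : Poly2) = - C (b / s) := by rw [← C_neg]; congr 1; ring
          rw [e1, e3, C_neg]
          linear_combination (X 0) * e2
        · have hi : i = 1 := by omega
          refine ⟨C (b / s), ?_⟩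
          simp only [g, hi, T, l]
          simp only [one_ne_zero, if_false, map_add, map_mul, Polynomial.aeval_C, Polynomial.aeval_X, algebraMap_eq]
          have e1 : (C (-b * c / s) : Poly2) = - C c * C (b / s) := by
            rw [← C_neg, ← C_mul]; congr 1; ring
          have e2 : (1 : Poly2) = C a * C (a / s) + C b * C (b / s) := by
            rw [← C_mul, ← C_mul, ← C_add, ← C_1]; congr 1; field_simp; rw [hsdef]
          have e3 : (C (-b / s) : Poly2) = - C (b / s) := by rw [← C_neg]; congr 1; ring
          rw [e1, e3]
          linear_combination (X 1) * e2
      conv_lhs => rw [this]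
      rfl
    rw [hφ, map_zero] at this
    exact this
  obtain ⟨r, hr⟩ := hdvd
  refine ⟨r, hr, ?_⟩
  by_cases h0 : r = 0
  · exact Or.inl h0
  · right
    have hl0 : l ≠ 0 := by
      intro h; rw [h] at hl; simp at hl
    rw [hr, totalDegree_mul_of_isDomain hl0 h0, hl] at hp
    omega

lemma line_same (l q : Poly2) (A B : ℝ × ℝ) (hl : l.totalDegree = 1) (hq : q.totalDegree = 1)
    (hAB : A ≠ B) (h1 : evalPt l A = 0) (h2 : evalPt l B = 0) (h3 : evalPt q A = 0)
    (h4 : evalPt q B = 0) : ∃ c : ℝ, c ≠ 0 ∧ q = l * C c := by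
  classical
  obtain ⟨r, hr, h⟩ := line_dvd l q 1 {A, B} hl hq.le (by simp [h1, h2]) (by simp [h3, h4])
    (by rw [Finset.card_pair hAB]; omega)
  have hr0 : r ≠ 0 := by rintro rfl; rw [hr] at hq; simp at hq
  have hd : r.totalDegree = 0 := by
    rcases h with h | h
    · exact absurd h hr0
    · omega
  rw [totalDegree_eq_zero_iff_eq_C] at hd
  refine ⟨_, ?_, hd ▸ hr⟩
  intro h
  rw [h] at hd
  exact hr0 (by simpa using hd)

lemma line_same_zero (l q : Poly2) (A B : ℝ × ℝ) (hl : l.totalDegree = 1) (hq : q.totalDegree = 1)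
    (hAB : A ≠ B) (h1 : evalPt l A = 0) (h2 : evalPt l B = 0) (h3 : evalPt q A = 0)
    (h4 : evalPt q B = 0) : zeroSet q = zeroSet l := by
  obtain ⟨c, hc, rfl⟩ := line_same l q A B hl hq hAB h1 h2 h3 h4
  ext P
  simp [zeroSet, evalPt_mul, evalPt_C, hc]

lemma line_kill (l p : Poly2) (d : ℕ) (S : Finset (ℝ × ℝ)) (hl : l.totalDegree = 1)
    (hp : p.totalDegree ≤ d) (hSl : ∀ A ∈ S, evalPt l A = 0) (hSp : ∀ A ∈ S, evalPt p A = 0)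
    (hS : d < S.card) (A : ℝ × ℝ) (hA : evalPt l A = 0) : evalPt p A = 0 := by
  obtain ⟨r, rfl, -⟩ := line_dvd l p d S hl hp hSl hSp hS
  rw [evalPt_mul, hA, zero_mul]

lemma two_pts {l q : Poly2} {A B : ℝ × ℝ} (hl : l.totalDegree = 1) (hq : q.totalDegree = 1)
    (hne : zeroSet l ≠ zeroSet q) (h1 : evalPt l A = 0) (h2 : evalPt l B = 0)
    (h3 : evalPt q A = 0) (h4 : evalPt q B = 0) : A = B := by
  by_contra hAB
  exact hne (line_same_zero q l A B hq hl hAB h3 h4 h1 h2)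

lemma not_same {l q : Poly2} {A : ℝ × ℝ} (h1 : evalPt l A = 0) (h2 : evalPt q A ≠ 0) :
    zeroSet l ≠ zeroSet q := by
  intro h
  have : A ∈ zeroSet l := h1
  rw [h] at this
  exact h2 this

/-- A fundamental polynomial of `A` for the node set `N ∪ Y`. -/
structure FundP (n : ℕ) (N Y : Finset (ℝ × ℝ)) (A : ℝ × ℝ) (p : Poly2) : Prop where
  deg : p.totalDegree ≤ n
  one : evalPt p A = 1
  zN : ∀ B ∈ N, B ≠ A → evalPt p B = 0
  zY : ∀ B ∈ Y, B ≠ A → evalPt p B = 0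

/-- A `GC_n` set split as the nodes `N` on a maximal line `lam` and the remaining nodes `Y`. -/
structure Cfg (n : ℕ) (N Y : Finset (ℝ × ℝ)) (lam : Poly2) : Prop where
  hn : 1 ≤ n
  hl : lam.totalDegree = 1
  hN : ∀ A ∈ N, evalPt lam A = 0
  hY : ∀ A ∈ Y, evalPt lam A ≠ 0
  card : N.card = n + 1
  fund : ∀ A, A ∈ N ∨ A ∈ Y → ∃ p, FundP n N Y A p ∧
    ∃ f : Fin n → Poly2, (∀ i, (f i).totalDegree = 1) ∧ p = ∏ i, f i

/-- A maximal line of `Y`. -/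
structure MaxY (n : ℕ) (Y : Finset (ℝ × ℝ)) (M : Poly2) : Prop where
  deg : M.totalDegree = 1
  card : (nodesOn Y M).card = n

section geometry

variable {n : ℕ} {N Y : Finset (ℝ × ℝ)} {lam : Poly2}

lemma fundY (h : Cfg n N Y lam) {A : ℝ × ℝ} (hA : A ∈ Y) :
    ∃ r : Poly2, r.totalDegree + 1 ≤ n ∧ evalPt r A ≠ 0 ∧ ∀ B ∈ Y, B ≠ A → evalPt r B = 0 := by
  obtain ⟨p, hp, -⟩ := h.fund A (Or.inr hA)
  obtain ⟨r, rfl, hr⟩ := line_dvd lam p n N h.hl hp.deg h.hN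
    (fun B hB => hp.zN B hB (by rintro rfl; exact h.hY B hA (h.hN B hB))) (by rw [h.card]; omega)
  have hrA : evalPt r A ≠ 0 := by
    intro h0
    have := hp.one
    rw [evalPt_mul, h0] at this
    simp at this
  refine ⟨r, ?_, hrA, ?_⟩
  · rcases hr with rfl | hr
    · exact absurd (evalPt_zero A) hrA
    · exact hr
  · intro B hB hBA
    have := hp.zY B hB hBA
    rw [evalPt_mul] at this
    exact (mul_eq_zero.1 this).resolve_left (h.hY B hB)

lemma card_le_Y (h : Cfg n N Y lam) {l : Poly2} (hl : l.totalDegree = 1) :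
    (nodesOn Y l).card ≤ n := by
  classical
  by_contra hc
  push Not at hc
  obtain ⟨A, hA⟩ : (nodesOn Y l).Nonempty := Finset.card_pos.1 (by omega)
  obtain ⟨hAY, hAl⟩ := mem_nodesOn.1 hA
  obtain ⟨r, hr, hrA, hz⟩ := fundY h hAY
  refine hrA (line_kill l r (n - 1) ((nodesOn Y l).erase A) hl (by omega) ?_ ?_ ?_ A hAl)
  · intro B hB
    exact (mem_nodesOn.1 (Finset.mem_of_mem_erase hB)).2
  · intro B hB
    exact hz B (mem_nodesOn.1 (Finset.mem_of_mem_erase hB)).1 (Finset.ne_of_mem_erase hB)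
  · rw [Finset.card_erase_of_mem hA]; have := h.hn; omega

lemma fundY2 (h : Cfg n N Y lam) {M : Poly2} (hM : MaxY n Y M) {A : ℝ × ℝ} (hA : A ∈ Y)
    (hAM : evalPt M A ≠ 0) :
    ∃ r : Poly2, r.totalDegree + 2 ≤ n ∧ evalPt r A ≠ 0 ∧
      ∀ B ∈ Y, B ≠ A → evalPt M B ≠ 0 → evalPt r B = 0 := by
  obtain ⟨p, hp, hpA, hz⟩ := fundY h hA
  obtain ⟨r, rfl, hr⟩ := line_dvd M p (n - 1) (nodesOn Y M) hM.deg (by omega)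
    (fun B hB => (mem_nodesOn.1 hB).2)
    (fun B hB => hz B (mem_nodesOn.1 hB).1 (by rintro rfl; exact hAM (mem_nodesOn.1 hB).2))
    (by rw [hM.card]; have := h.hn; omega)
  have hrA : evalPt r A ≠ 0 := by
    intro h0
    rw [evalPt_mul, h0] at hpA
    simp at hpA
  refine ⟨r, ?_, hrA, ?_⟩
  · rcases hr with rfl | hr
    · exact absurd (evalPt_zero A) hrA
    · omega
  · intro B hB hBA hBM
    have := hz B hB hBA
    rw [evalPt_mul] at this
    exact (mul_eq_zero.1 this).resolve_left hBM

lemma meet (h : Cfg n N Y lam) {M M' : Poly2} (hM : MaxY n Y M) (hM' : MaxY n Y M') :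
    ∃ B ∈ Y, evalPt M B = 0 ∧ evalPt M' B = 0 := by
  classical
  by_contra! hc
  obtain ⟨A, hA⟩ : (nodesOn Y M').Nonempty :=
    Finset.card_pos.1 (by rw [hM'.card]; exact h.hn)
  obtain ⟨hAY, hAl⟩ := mem_nodesOn.1 hA
  obtain ⟨r, hr, hrA, hz⟩ := fundY2 h hM hAY (fun h0 => hc A hAY h0 hAl)
  refine hrA (line_kill M' r (n - 2) ((nodesOn Y M').erase A) hM'.deg (by omega) ?_ ?_ ?_ A hAl)
  · intro B hB
    exact (mem_nodesOn.1 (Finset.mem_of_mem_erase hB)).2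
  · intro B hB
    obtain ⟨hBY, hBM⟩ := mem_nodesOn.1 (Finset.mem_of_mem_erase hB)
    exact hz B hBY (Finset.ne_of_mem_erase hB) (fun h0 => hc B hBY h0 hBM)
  · rw [Finset.card_erase_of_mem hA, hM'.card]; omega

lemma not_conc (h : Cfg n N Y lam) (hn2 : 2 ≤ n) {M1 M2 M3 : Poly2} (h1 : MaxY n Y M1)
    (h2 : MaxY n Y M2) (h3 : MaxY n Y M3) (h12 : zeroSet M1 ≠ zeroSet M2)
    (h13 : zeroSet M1 ≠ zeroSet M3) (h23 : zeroSet M2 ≠ zeroSet M3) {B : ℝ × ℝ} (hB : B ∈ Y)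
    (hB1 : evalPt M1 B = 0) (hB2 : evalPt M2 B = 0) : evalPt M3 B ≠ 0 := by
  classical
  intro hB3
  have hBm : B ∈ nodesOn Y M3 := mem_nodesOn.2 ⟨hB, hB3⟩
  obtain ⟨A, hA⟩ : ((nodesOn Y M3).erase B).Nonempty :=
    Finset.card_pos.1 (by rw [Finset.card_erase_of_mem hBm, h3.card]; omega)
  obtain ⟨hAB, hAm⟩ := Finset.mem_erase.1 hA
  obtain ⟨hAY, hA3⟩ := mem_nodesOn.1 hAm
  have hA1 : evalPt M1 A ≠ 0 := fun h0 => hAB (two_pts h1.deg h3.deg h13 h0 hB1 hA3 hB3)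
  have hA2 : evalPt M2 A ≠ 0 := fun h0 => hAB (two_pts h2.deg h3.deg h23 h0 hB2 hA3 hB3)
  obtain ⟨r, hr, hrA, hz⟩ := fundY2 h h1 hAY hA1
  have hB2m : B ∈ nodesOn Y M2 := mem_nodesOn.2 ⟨hB, hB2⟩
  obtain ⟨s, rfl, hs⟩ := line_dvd M2 r (n - 2) ((nodesOn Y M2).erase B) h2.deg (by omega)
    (fun P hP => (mem_nodesOn.1 (Finset.mem_of_mem_erase hP)).2)
    (by
      intro P hP
      obtain ⟨hPB, hPm⟩ := Finset.mem_erase.1 hP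
      obtain ⟨hPY, hP2⟩ := mem_nodesOn.1 hPm
      exact hz P hPY (by rintro rfl; exact hA2 hP2)
        (fun h0 => hPB (two_pts h1.deg h2.deg h12 h0 hB1 hP2 hB2)))
    (by rw [Finset.card_erase_of_mem hB2m, h2.card]; omega)
  have hsA : evalPt s A ≠ 0 := by
    intro h0
    rw [evalPt_mul, h0] at hrA
    simp at hrA
  have hs : s.totalDegree + 1 ≤ n - 2 := by
    rcases hs with rfl | hs
    · exact absurd (evalPt_zero A) hsA
    · exact hs
  refine hsA (line_kill M3 s (n - 3) (((nodesOn Y M3).erase B).erase A) h3.deg (by omega)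
    ?_ ?_ ?_ A hA3)
  · intro P hP
    exact (mem_nodesOn.1 (Finset.mem_of_mem_erase (Finset.mem_of_mem_erase hP))).2
  · intro P hP
    obtain ⟨hPA, hP⟩ := Finset.mem_erase.1 hP
    obtain ⟨hPB, hPm⟩ := Finset.mem_erase.1 hP
    obtain ⟨hPY, hP3⟩ := mem_nodesOn.1 hPm
    have hP1 : evalPt M1 P ≠ 0 := fun h0 => hPB (two_pts h1.deg h3.deg h13 h0 hB1 hP3 hB3)
    have hP2 : evalPt M2 P ≠ 0 := fun h0 => hPB (two_pts h2.deg h3.deg h23 h0 hB2 hP3 hB3)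
    have := hz P hPY hPA hP1
    rw [evalPt_mul] at this
    exact (mul_eq_zero.1 this).resolve_left hP2
  · rw [Finset.card_erase_of_mem hA, Finset.card_erase_of_mem hBm, h3.card]; omega

lemma not_factor (h : Cfg n N Y lam) {M s : Poly2} (hM : M.totalDegree = 1)
    (hMN : ∀ P ∈ N, evalPt M P ≠ 0) {A : ℝ × ℝ} (hA : A ∈ N) (hp : FundP n N Y A (M * s)) :
    False := by
  classical
  have hsA : evalPt s A ≠ 0 := by
    intro h0
    have := hp.one
    rw [evalPt_mul, h0] at this
    simp at this
  have hs0 : s ≠ 0 := by rintro rfl; exact hsA (evalPt_zero A)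
  have hM0 : M ≠ 0 := by rintro rfl; simp at hM
  have hd := hp.deg
  rw [totalDegree_mul_of_isDomain hM0 hs0, hM] at hd
  refine hsA (line_kill lam s (n - 1) (N.erase A) h.hl (by omega)
    (fun P hP => h.hN P (Finset.mem_of_mem_erase hP)) ?_ ?_ A (h.hN A hA))
  · intro P hP
    obtain ⟨hPA, hP⟩ := Finset.mem_erase.1 hP
    have := hp.zN P hP hPA
    rw [evalPt_mul] at this
    exact (mul_eq_zero.1 this).resolve_left (hMN P hP)
  · rw [Finset.card_erase_of_mem hA, h.card]; omega

/-- Data of a splitting `p_A = q * r` with `q` the line through `B`. -/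
structure Spl (n : ℕ) (N Y : Finset (ℝ × ℝ)) (B A D : ℝ × ℝ) (q r : Poly2) : Prop where
  fund : FundP n N Y A (q * r)
  dq : q.totalDegree = 1
  dr : r.totalDegree + 1 ≤ n
  qB : evalPt q B = 0
  rB : evalPt r B ≠ 0
  D_mem : D ∈ N
  D_ne : D ≠ A
  qD : evalPt q D = 0
  qA : evalPt q A ≠ 0
  rA : evalPt r A ≠ 0

lemma exists_spl (h : Cfg n N Y lam) {M : Poly2} (hM : MaxY n Y M)
    (hMN : ∀ P ∈ N, evalPt M P ≠ 0) {B : ℝ × ℝ} (hB : B ∈ Y) (hBM : evalPt M B = 0)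
    {A : ℝ × ℝ} (hA : A ∈ N) : ∃ D q r, Spl n N Y B A D q r := by
  classical
  obtain ⟨p, hp, f, hf, hpf⟩ := h.fund A (Or.inl hA)
  have hBA : B ≠ A := by rintro rfl; exact h.hY B hB (h.hN B hA)
  have hpB := hp.zY B hB hBA
  obtain ⟨i, hi⟩ : ∃ i, evalPt (f i) B = 0 := by
    rw [hpf, evalPt, map_prod, Finset.prod_eq_zero_iff] at hpB
    obtain ⟨i, -, hi⟩ := hpB
    exact ⟨i, hi⟩
  set r := ∏ j ∈ Finset.univ.erase i, f j with hr
  have hpr : p = f i * r := by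
    rw [hpf, hr, Finset.mul_prod_erase _ _ (Finset.mem_univ i)]
  have hdr : r.totalDegree + 1 ≤ n := by
    have h1 : r.totalDegree ≤ ∑ j ∈ Finset.univ.erase i, (f j).totalDegree :=
      totalDegree_finsetProd _ _
    have h2 : ∑ j ∈ Finset.univ.erase i, (f j).totalDegree = n - 1 := by
      simp [hf]
    have := h.hn
    omega
  clear_value r
  subst hpr
  have hone := hp.one
  rw [evalPt_mul] at hone
  have hqA : evalPt (f i) A ≠ 0 := by intro h0; simp [h0] at hone
  have hrA : evalPt r A ≠ 0 := by intro h0; simp [h0] at hone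
  have hfac : ∀ s, f i * r ≠ M * s := fun s hs => not_factor h hM.deg hMN hA (hs ▸ hp)
  have hBm : B ∈ nodesOn Y M := mem_nodesOn.2 ⟨hB, hBM⟩
  obtain ⟨D, hD, hDA, hqD⟩ : ∃ D ∈ N, D ≠ A ∧ evalPt (f i) D = 0 := by
    by_contra! hc
    refine hrA (line_kill lam r (n - 1) (N.erase A) h.hl (by omega)
      (fun P hP => h.hN P (Finset.mem_of_mem_erase hP)) ?_ ?_ A (h.hN A hA))
    · intro P hP
      obtain ⟨hPA, hP⟩ := Finset.mem_erase.1 hP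
      have := hp.zN P hP hPA
      rw [evalPt_mul] at this
      exact (mul_eq_zero.1 this).resolve_left (hc P hP hPA)
    · rw [Finset.card_erase_of_mem hA, h.card]; have := h.hn; omega
  have hrB : evalPt r B ≠ 0 := by
    intro h0
    by_cases hq : zeroSet M = zeroSet (f i)
    · exact not_same hqD (hMN D hD) hq.symm
    · obtain ⟨s, hs, -⟩ := line_dvd M r (n - 1) (nodesOn Y M) hM.deg (by omega)
        (fun P hP => (mem_nodesOn.1 hP).2)
        (by
          intro P hP
          obtain ⟨hPY, hPM⟩ := mem_nodesOn.1 hP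
          by_cases hPB : P = B
          · rw [hPB]; exact h0
          · have hPA : P ≠ A := by rintro rfl; exact h.hY P hPY (h.hN P hA)
            have := hp.zY P hPY hPA
            rw [evalPt_mul] at this
            exact (mul_eq_zero.1 this).resolve_left
              (fun h0 => hPB (two_pts hM.deg (hf i) hq hPM hBM h0 hi)))
        (by rw [hM.card]; have := h.hn; omega)
      exact hfac (f i * s) (by rw [hs]; ring)
  exact ⟨D, f i, r, hp, hf i, hdr, hi, hrB, hD, hDA, hqD, hqA, hrA⟩

lemma spl_inj (h : Cfg n N Y lam) {M1 M2 : Poly2} (h1 : MaxY n Y M1) (h2 : MaxY n Y M2)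
    (h12 : zeroSet M1 ≠ zeroSet M2) (hN1 : ∀ P ∈ N, evalPt M1 P ≠ 0)
    (hN2 : ∀ P ∈ N, evalPt M2 P ≠ 0) {B : ℝ × ℝ} (hB : B ∈ Y) (hB1 : evalPt M1 B = 0)
    (hB2 : evalPt M2 B = 0) {A A' D : ℝ × ℝ} {q r q' r' : Poly2} (hA : A ∈ N) (hA' : A' ∈ N)
    (s : Spl n N Y B A D q r) (s' : Spl n N Y B A' D q' r') : A = A' := by
  classical
  by_contra hAA
  have hBD : B ≠ D := by rintro rfl; exact h.hY B hB (h.hN B s.D_mem)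
  obtain ⟨c, hc, rfl⟩ := line_same q q' B D s.dq s'.dq hBD s.qB s.qD s'.qB s'.qD
  have hvan : ∀ M : Poly2, MaxY n Y M → (∀ P ∈ N, evalPt M P ≠ 0) → evalPt M B = 0 →
      ∀ P ∈ nodesOn Y M, P ≠ B → evalPt r P = 0 ∧ evalPt r' P = 0 := by
    intro M hM hMN hMB P hP hPB
    obtain ⟨hPY, hPM⟩ := mem_nodesOn.1 hP
    have hq : evalPt q P ≠ 0 := fun h0 =>
      hPB (two_pts s.dq hM.deg (not_same s.qD (hMN D s.D_mem)) h0 s.qB hPM hMB)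
    have hPN : P ∉ N := fun hN => h.hY P hPY (h.hN P hN)
    have e1 := s.fund.zY P hPY (by rintro rfl; exact hPN hA)
    have e2 := s'.fund.zY P hPY (by rintro rfl; exact hPN hA')
    simp only [evalPt_mul, evalPt_C, mul_eq_zero, hq, hc, false_or] at e1 e2
    exact ⟨e1, e2⟩
  set x := evalPt r B with hx
  set y := evalPt r' B with hy
  set e : Poly2 := C y * r - C x * r' with he
  have heB : evalPt e B = 0 := by
    simp only [he, evalPt_sub, evalPt_mul, evalPt_C]
    rw [← hx, ← hy]; ring
  have hed : e.totalDegree + 1 ≤ n := by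
    have e1 : (C y * r).totalDegree ≤ r.totalDegree := by
      simpa using totalDegree_mul (C y) r
    have e2 : (C x * r').totalDegree ≤ r'.totalDegree := by
      simpa using totalDegree_mul (C x) r'
    have e3 := totalDegree_sub (C y * r) (C x * r')
    have := s.dr
    have := s'.dr
    rw [he]
    omega
  have heA : evalPt e A ≠ 0 := by
    have hr'A : evalPt r' A = 0 := by
      have := s'.fund.zN A hA hAA
      simpa only [evalPt_mul, evalPt_C, mul_eq_zero, s.qA, hc, false_or] using this
    simp only [he, evalPt_sub, evalPt_mul, evalPt_C, hr'A]
    simpa using ⟨s'.rB, s.rA⟩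
  have heN : ∀ P ∈ N, P ≠ A → P ≠ A' → evalPt (q * e) P = 0 := by
    intro P hP hPA hPA'
    have e1 := s.fund.zN P hP hPA
    have e2 := s'.fund.zN P hP hPA'
    simp only [he, evalPt_sub, evalPt_mul, evalPt_C] at e1 e2 ⊢
    have e3 : evalPt q P * evalPt r' P = 0 := by
      apply mul_left_cancel₀ hc
      linear_combination e2
    linear_combination y * e1 - x * e3
  have heM : ∀ M : Poly2, MaxY n Y M → (∀ P ∈ N, evalPt M P ≠ 0) → evalPt M B = 0 →
      ∀ P ∈ nodesOn Y M, evalPt e P = 0 := by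
    intro M hM hMN hMB P hP
    by_cases hPB : P = B
    · rw [hPB, heB]
    · obtain ⟨e1, e2⟩ := hvan M hM hMN hMB P hP hPB
      simp [he, evalPt_sub, evalPt_mul, e1, e2]
  have heM1 := heM M1 h1 hN1 hB1
  have heM2 := heM M2 h2 hN2 hB2
  clear_value e
  obtain ⟨u, rfl, hu⟩ := line_dvd M1 e (n - 1) (nodesOn Y M1) h1.deg (by omega)
    (fun P hP => (mem_nodesOn.1 hP).2) heM1 (by rw [h1.card]; omega)
  have huA : evalPt u A ≠ 0 := fun h0 => heA (by rw [evalPt_mul, h0, mul_zero])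
  have hu : u.totalDegree + 2 ≤ n := by
    rcases hu with rfl | hu
    · exact absurd (evalPt_zero A) huA
    · omega
  obtain ⟨v, rfl, hv⟩ := line_dvd M2 u (n - 2) ((nodesOn Y M2).erase B) h2.deg (by omega)
    (fun P hP => (mem_nodesOn.1 (Finset.mem_of_mem_erase hP)).2)
    (by
      intro P hP
      obtain ⟨hPB, hPm⟩ := Finset.mem_erase.1 hP
      obtain ⟨hPY, hP2⟩ := mem_nodesOn.1 hPm
      have := heM2 P hPm
      rw [evalPt_mul] at this
      exact (mul_eq_zero.1 this).resolve_left
        (fun h0 => hPB (two_pts h1.deg h2.deg h12 h0 hB1 hP2 hB2)))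
    (by rw [Finset.card_erase_of_mem (mem_nodesOn.2 ⟨hB, hB2⟩), h2.card]; omega)
  have hvA : evalPt v A ≠ 0 := fun h0 => huA (by rw [evalPt_mul, h0, mul_zero])
  have hv : v.totalDegree + 3 ≤ n := by
    rcases hv with rfl | hv
    · exact absurd (evalPt_zero A) hvA
    · omega
  have hqv : evalPt (q * v) A = 0 := by
    refine line_kill lam (q * v) (n - 2) ((N.erase A).erase A') h.hl ?_
      (fun P hP => h.hN P (Finset.mem_of_mem_erase (Finset.mem_of_mem_erase hP))) ?_ ?_ A (h.hN A hA)
    · have := totalDegree_mul q v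
      rw [s.dq] at this
      omega
    · intro P hP
      obtain ⟨hPA', hP⟩ := Finset.mem_erase.1 hP
      obtain ⟨hPA, hP⟩ := Finset.mem_erase.1 hP
      have := heN P hP hPA hPA'
      simpa only [evalPt_mul, mul_eq_zero, hN1 P hP, hN2 P hP, false_or] using this
    · rw [Finset.card_erase_of_mem (Finset.mem_erase.2 ⟨Ne.symm hAA, hA'⟩),
        Finset.card_erase_of_mem hA, h.card]
      omega
  rw [evalPt_mul] at hqv
  exact (mul_ne_zero s.qA hvA) hqv

lemma key_contra (h : Cfg n N Y lam) (hn2 : 2 ≤ n) {M1 M2 M3 : Poly2} (h1 : MaxY n Y M1)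
    (h2 : MaxY n Y M2) (h3 : MaxY n Y M3) (h12 : zeroSet M1 ≠ zeroSet M2)
    (h13 : zeroSet M1 ≠ zeroSet M3) (h23 : zeroSet M2 ≠ zeroSet M3)
    (hN1 : ∀ P ∈ N, evalPt M1 P ≠ 0) (hN2 : ∀ P ∈ N, evalPt M2 P ≠ 0) : False := by
  classical
  obtain ⟨B, hB, hB1, hB2⟩ := meet h h1 h2
  have hB3 := not_conc h hn2 h1 h2 h3 h12 h13 h23 hB hB1 hB2
  have hex : ∀ A, ∃ D q r, A ∈ N → Spl n N Y B A D q r := by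
    intro A
    by_cases hA : A ∈ N
    · obtain ⟨D, q, r, hs⟩ := exists_spl h h1 hN1 hB hB1 hA
      exact ⟨D, q, r, fun _ => hs⟩
    · exact ⟨0, 0, 0, fun h0 => absurd h0 hA⟩
  choose D q r hs using hex
  have hDinj : ∀ A ∈ N, ∀ A' ∈ N, D A = D A' → A = A' := by
    intro A hA A' hA' hD
    have s' := hs A' hA'
    rw [← hD] at s'
    exact spl_inj h h1 h2 h12 hN1 hN2 hB hB1 hB2 hA hA' (hs A hA) s'
  have hYN : ∀ P ∈ Y, P ∉ N := fun P hP hPN => h.hY P hP (h.hN P hPN)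
  by_cases hC : ∃ C ∈ N, evalPt M3 C = 0
  · obtain ⟨C, hCN, hC3⟩ := hC
    have hDC : ∀ A ∈ N, D A ≠ C := by
      intro A hA hDA
      have s := hs A hA
      have hAC : A ≠ C := by
        rintro rfl
        exact s.D_ne hDA
      have hqC : evalPt (q A) C = 0 := hDA ▸ s.qD
      obtain ⟨u, hu, hud⟩ := line_dvd M3 (r A) (n - 1) (nodesOn Y M3) h3.deg
        (by have := s.dr; omega) (fun P hP => (mem_nodesOn.1 hP).2)
        (by
          intro P hP
          obtain ⟨hPY, hP3⟩ := mem_nodesOn.1 hP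
          have := s.fund.zY P hPY (by rintro rfl; exact hYN _ hPY hA)
          rw [evalPt_mul] at this
          refine (mul_eq_zero.1 this).resolve_left (fun h0 => hYN P hPY ?_)
          rw [two_pts s.dq h3.deg (not_same s.qB hB3) h0 hqC hP3 hC3]
          exact hCN)
        (by rw [h3.card]; omega)
      have huA : evalPt u A ≠ 0 := fun h0 => s.rA (by rw [hu, evalPt_mul, h0, mul_zero])
      have hud : u.totalDegree + 2 ≤ n := by
        rcases hud with rfl | hud
        · exact absurd (evalPt_zero A) huA
        · omega
      refine huA (line_kill lam u (n - 2) ((N.erase A).erase C) h.hl (by omega)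
        (fun P hP => h.hN P (Finset.mem_of_mem_erase (Finset.mem_of_mem_erase hP))) ?_ ?_ A
        (h.hN A hA))
      · intro P hP
        obtain ⟨hPC, hP⟩ := Finset.mem_erase.1 hP
        obtain ⟨hPA, hP⟩ := Finset.mem_erase.1 hP
        have hqP : evalPt (q A) P ≠ 0 := fun h0 => hPC
          (two_pts h.hl s.dq (not_same (h.hN A hA) s.qA) (h.hN P hP) (h.hN C hCN) h0 hqC)
        obtain ⟨R, hR⟩ : (nodesOn Y M3).Nonempty := Finset.card_pos.1 (by rw [h3.card]; omega)
        obtain ⟨hRY, hR3⟩ := mem_nodesOn.1 hR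
        have hP3 : evalPt M3 P ≠ 0 := fun h0 => hPC
          (two_pts h3.deg h.hl (not_same hR3 (h.hY R hRY)) h0 hC3 (h.hN P hP) (h.hN C hCN))
        have := s.fund.zN P hP hPA
        rw [hu] at this
        simpa only [evalPt_mul, mul_eq_zero, hqP, hP3, false_or] using this
      · rw [Finset.card_erase_of_mem (Finset.mem_erase.2 ⟨hAC.symm, hCN⟩),
          Finset.card_erase_of_mem hA, h.card]
        omega
    have hle : N.card ≤ (N.erase C).card := Finset.card_le_card_of_injOn D
      (fun A hA => Finset.mem_erase.2 ⟨hDC A hA, (hs A hA).D_mem⟩)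
      (fun A hA A' hA' => hDinj A hA A' hA')
    rw [Finset.card_erase_of_mem hCN, h.card] at hle
    omega
  · push Not at hC
    have hE : ∀ A, ∃ E, A ∈ N → E ∈ nodesOn Y M3 ∧ evalPt (q A) E = 0 := by
      intro A
      by_cases hA : A ∈ N
      swap
      · exact ⟨0, fun h0 => absurd h0 hA⟩
      have s := hs A hA
      by_contra! hc
      obtain ⟨u, hu, -⟩ := line_dvd M3 (r A) (n - 1) (nodesOn Y M3) h3.deg
        (by have := s.dr; omega) (fun P hP => (mem_nodesOn.1 hP).2)
        (by
          intro P hP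
          obtain ⟨hPY, hP3⟩ := mem_nodesOn.1 hP
          have := s.fund.zY P hPY (by rintro rfl; exact hYN _ hPY hA)
          rw [evalPt_mul] at this
          exact (mul_eq_zero.1 this).resolve_left ((hc P).2 hP))
        (by rw [h3.card]; omega)
      refine not_factor h h3.deg hC hA (s := q A * u) ?_
      have := s.fund
      rw [hu] at this
      convert this using 1
      ring
    choose E hE using hE
    have hle : N.card ≤ (nodesOn Y M3).card := Finset.card_le_card_of_injOn E
      (fun A hA => (hE A hA).1)
      (by
        intro A hA A' hA' hEE
        have hA : A ∈ N := hA
        have hA' : A' ∈ N := hA'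
        have s := hs A hA
        have s' := hs A' hA'
        obtain ⟨m, hq⟩ := hE A hA
        obtain ⟨m', hq'⟩ := hE A' hA'
        rw [← hEE] at hq'
        have hBE : B ≠ E A := by
          intro h0
          exact hB3 (h0 ▸ (mem_nodesOn.1 m).2)
        obtain ⟨c, hc, hqc⟩ := line_same (q A) (q A') B (E A) s.dq s'.dq hBE s.qB hq s'.qB hq'
        apply hDinj A hA A' hA'
        have hqD : evalPt (q A) (D A') = 0 := by
          have := s'.qD
          rw [hqc, evalPt_mul, evalPt_C] at this
          exact (mul_eq_zero.1 this).resolve_right hc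
        exact two_pts h.hl s.dq (not_same (h.hN A hA) s.qA) (h.hN _ s.D_mem) (h.hN _ s'.D_mem)
          s.qD hqD)
    rw [h.card, h3.card] at hle
    omega

end geometry

lemma cfg_of_GC {n : ℕ} {X : Finset (ℝ × ℝ)} (hX : IsGC n X) {lam : Poly2}
    (hlam : IsMaximalLine n X lam) (hn : 1 ≤ n) :
    Cfg n (nodesOn X lam) (X \ nodesOn X lam) lam where
  hn := hn
  hl := hlam.1
  hN := fun A hA => (mem_nodesOn.1 hA).2
  hY := fun A hA h0 => by
    rw [Finset.mem_sdiff] at hA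
    exact hA.2 (mem_nodesOn.2 ⟨hA.1, h0⟩)
  card := hlam.2
  fund := by
    intro A hA
    have hAX : A ∈ X := by
      rcases hA with hA | hA
      · exact (mem_nodesOn.1 hA).1
      · exact (Finset.mem_sdiff.1 hA).1
    obtain ⟨p, hp, hf⟩ := hX.2 A hAX
    exact ⟨p, ⟨hp.1, hp.2.1, fun B hB => hp.2.2 B (mem_nodesOn.1 hB).1,
      fun B hB => hp.2.2 B (Finset.mem_sdiff.1 hB).1⟩, hf⟩

lemma nodes_split (X : Finset (ℝ × ℝ)) (lam l : Poly2) :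
    (nodesOn X l).card = (nodesOn (X \ nodesOn X lam) l).card +
      (nodesOn (nodesOn X lam) l).card := by
  classical
  rw [← Finset.card_union_of_disjoint]
  · congr 1
    ext A
    simp only [Finset.mem_union, mem_nodesOn, Finset.mem_sdiff]
    tauto
  · rw [Finset.disjoint_left]
    intro A hA hA'
    simp only [mem_nodesOn, Finset.mem_sdiff] at hA hA'
    tauto

lemma mu_point (P : ℝ × ℝ) : mu 0 {P} = 0 := by
  apply Set.Infinite.ncard
  have hinj : Function.Injective (fun k : ℝ => zeroSet (X 0 + C k * X 1 - C (P.1 + k * P.2))) := by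
    intro k k' hk
    simp only at hk
    have : (P.1 - k, P.2 + 1) ∈ zeroSet (X 0 + C k * X 1 - C (P.1 + k * P.2)) := by
      simp [zeroSet, evalPt]; ring
    rw [hk] at this
    simp [zeroSet, evalPt] at this
    linarith
  refine (Set.infinite_range_of_injective hinj).mono ?_
  rintro _ ⟨k, rfl⟩
  refine ⟨_, ⟨?_, ?_⟩, rfl⟩
  · apply le_antisymm
    · refine (totalDegree_sub_C_le _ _).trans ((totalDegree_add _ _).trans ?_)
      have := totalDegree_mul (C k : Poly2) (X 1)
      simp at this ⊢
      exact this
    · by_contra hlt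
      have h0 : coeff (Finsupp.single 0 1) (X 0 + C k * X 1 - C (P.1 + k * P.2) : Poly2) = 0 := by
        apply coeff_eq_zero_of_totalDegree_lt
        rw [Finsupp.support_single_ne_zero _ one_ne_zero]
        simpa using hlt
      have e2 : (0 : Fin 2 →₀ ℕ) ≠ Finsupp.single 0 1 := by
        intro h'
        simpa using DFunLike.congr_fun h' 0
      simp [coeff_C_mul, coeff_X, coeff_C, e2, Finsupp.single_left_inj] at h0
  · have : nodesOn {P} (X 0 + C k * X 1 - C (P.1 + k * P.2)) = {P} := by
      ext A
      rw [mem_nodesOn, Finset.mem_singleton]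
      constructor
      · exact fun h => h.1
      · rintro rfl
        refine ⟨rfl, ?_⟩
        simp [evalPt]
    rw [this]; simp

/-- If `λ` is a maximal line of a `GC_n` set `X` with `μ(X \ λ) ≥ 3`, then
`μ(X \ λ) = μ(X)` or `μ(X \ λ) = μ(X) - 1`. -/
theorem stmt_16 (n : ℕ)
    (X : Finset (ℝ × ℝ)) (hX : IsGC n X)
    (lam : Poly2) (hlam : IsMaximalLine n X lam)
    (h3 : 3 ≤ mu (n - 1) (X \ nodesOn X lam)) :
    mu (n - 1) (X \ nodesOn X lam) = mu n X ∨
      mu (n - 1) (X \ nodesOn X lam) = mu n X - 1 := by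
  classical
  have hn2 : 2 ≤ n := by
    by_contra hn
    have hcard : (X \ nodesOn X lam).card = n := by
      rw [Finset.card_sdiff_of_subset (fun A hA => (mem_nodesOn.1 hA).1), hX.1.1, hlam.2]
      interval_cases n <;> simp <;> rfl
    have : n = 0 ∨ n = 1 := by omega
    rcases this with rfl | rfl
    · rw [Finset.card_eq_zero.1 hcard] at h3
      have : mu (0 - 1) ∅ = 0 := by
        unfold mu
        have : {L : Set (ℝ × ℝ) | ∃ ℓ : Poly2, IsMaximalLine (0 - 1) ∅ ℓ ∧ L = zeroSet ℓ} = ∅ := by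
          ext L
          simp only [Set.mem_setOf_eq, Set.mem_empty_iff_false, iff_false]
          rintro ⟨l, hl, -⟩
          have := hl.2
          simp [nodesOn] at this
        rw [this, Set.ncard_empty]
      omega
    · obtain ⟨P, hP⟩ := Finset.card_eq_one.1 hcard
      rw [hP] at h3
      have := mu_point P
      simp only [Nat.sub_self] at h3
      omega
  have h := cfg_of_GC hX hlam (by omega)
  have hn1 : n - 1 + 1 = n := by omega
  set N := nodesOn X lam with hN
  set Y := X \ N with hY
  unfold mu at h3 ⊢
  set MY := {L : Set (ℝ × ℝ) | ∃ ℓ : Poly2, IsMaximalLine (n - 1) Y ℓ ∧ L = zeroSet ℓ} with hMY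
  set MX := {L : Set (ℝ × ℝ) | ∃ ℓ : Poly2, IsMaximalLine n X ℓ ∧ L = zeroSet ℓ} with hMX
  have hfin : MY.Finite := Set.finite_of_ncard_ne_zero (by omega)
  have hmax : ∀ l, IsMaximalLine (n - 1) Y l → MaxY n Y l := fun l hl => ⟨hl.1, by rw [hl.2, hn1]⟩
  have hle1 : ∀ l : Poly2, l.totalDegree = 1 → zeroSet l ≠ zeroSet lam → (nodesOn N l).card ≤ 1 := by
    intro l hl hne
    rw [Finset.card_le_one]
    intro A hA B hB
    obtain ⟨hAN, hAl⟩ := mem_nodesOn.1 hA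
    obtain ⟨hBN, hBl⟩ := mem_nodesOn.1 hB
    exact two_pts hl h.hl hne hAl hBl (h.hN A hAN) (h.hN B hBN)
  have hneY : ∀ l, IsMaximalLine (n - 1) Y l → zeroSet l ≠ zeroSet lam := by
    intro l hl
    obtain ⟨A, hA⟩ : (nodesOn Y l).Nonempty := Finset.card_pos.1 (by rw [hl.2]; omega)
    obtain ⟨hAY, hAl⟩ := mem_nodesOn.1 hA
    exact not_same hAl (h.hY A hAY)
  have hlX : zeroSet lam ∈ MX := ⟨lam, hlam, rfl⟩
  have hlY : zeroSet lam ∉ MY := by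
    rintro ⟨l, hl, he⟩
    exact hneY l hl he.symm
  have hsub : MX \ {zeroSet lam} ⊆ MY := by
    rintro _ ⟨⟨l, hl, rfl⟩, hne⟩
    refine ⟨l, ⟨hl.1, ?_⟩, rfl⟩
    have e1 := nodes_split X lam l
    have e2 := hle1 l hl.1 hne
    have e3 := card_le_Y h hl.1
    rw [hl.2] at e1
    rw [← hN, ← hY] at e1
    omega
  have hfinX : MX.Finite := (hfin.insert (zeroSet lam)).subset (by
    intro L hL
    by_cases hLl : L = zeroSet lam
    · exact Or.inl hLl
    · exact Or.inr (hsub ⟨hL, hLl⟩))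
  have hmiss : ∀ l, IsMaximalLine (n - 1) Y l → zeroSet l ∉ MX → ∀ P ∈ N, evalPt l P ≠ 0 := by
    intro l hl hnot P hP h0
    apply hnot
    refine ⟨l, ⟨hl.1, ?_⟩, rfl⟩
    have e1 := nodes_split X lam l
    have e2 := hle1 l hl.1 (hneY l hl)
    have e3 : 0 < (nodesOn N l).card := Finset.card_pos.2 ⟨P, mem_nodesOn.2 ⟨hP, h0⟩⟩
    have e4 := hl.2
    rw [← hN, ← hY] at e1
    omega
  have hsing : ∀ L1 ∈ MY \ MX, ∀ L2 ∈ MY \ MX, L1 = L2 := by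
    rintro _ ⟨⟨l1, hl1, rfl⟩, hn1'⟩ _ ⟨⟨l2, hl2, rfl⟩, hn2'⟩
    by_contra hne
    obtain ⟨L3, hL3, hL3n⟩ : ∃ L3 ∈ MY, L3 ∉ ({zeroSet l1, zeroSet l2} : Set (Set (ℝ × ℝ))) := by
      refine Set.exists_mem_notMem_of_ncard_lt_ncard ?_ (Set.toFinite _)
      rw [Set.ncard_pair hne]
      omega
    obtain ⟨l3, hl3, rfl⟩ := hL3
    simp only [Set.mem_insert_iff, Set.mem_singleton_iff, not_or] at hL3n
    exact key_contra h hn2 (hmax l1 hl1) (hmax l2 hl2) (hmax l3 hl3) hne (Ne.symm hL3n.1)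
      (Ne.symm hL3n.2) (hmiss l1 hl1 hn1') (hmiss l2 hl2 hn2')
  have c1 : (MX \ {zeroSet lam}).ncard = MX.ncard - 1 := Set.ncard_diff_singleton_of_mem hlX
  have c0 : 0 < MX.ncard := (Set.ncard_pos hfinX).2 ⟨_, hlX⟩
  have c2 : (MX \ {zeroSet lam}).ncard ≤ MY.ncard := Set.ncard_le_ncard hsub hfin
  have c3 : (MY \ MX).ncard ≤ 1 := (Set.ncard_le_one (hfin.subset Set.diff_subset)).2 hsing
  have c4 : MY ⊆ (MX \ {zeroSet lam}) ∪ (MY \ MX) := by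
    intro L hL
    by_cases hLX : L ∈ MX
    · exact Or.inl ⟨hLX, by rintro rfl; exact hlY hL⟩
    · exact Or.inr ⟨hL, hLX⟩
  have c5 := Set.ncard_le_ncard c4
    ((hfinX.subset Set.diff_subset).union (hfin.subset Set.diff_subset))
  have c6 := Set.ncard_union_le (MX \ {zeroSet lam}) (MY \ MX)
  omega
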